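/- Let K be an algebraically closed field of characteristic 0, let 𝔮 be a finite-dimensional Lie algebra over K, let p ∈ K[t] be monic of degree n ≥ 2, and let l ∈ K[t] be nonzero with deg l ≤ 1. Let W = K[t]_{<n} ⊗_K 𝔮 and let ℓ be the bilinear map on W determined by ℓ(f⊗x, g⊗y) = (((fg) %ₘ p) − ((fg) %ₘ (p + l))) ⊗ [x,y] (note that this difference has degree < n, so ℓ takes values in W). Then min over γ in the dual space W* of dim{w ∈ W : γ(ℓ(w,u)) = 0 for all u ∈ W} equals dim 𝔮 + (n − 1)·ind 𝔮. -/

import Mathlib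

open TensorProduct Polynomial

/-- The stabiliser of `γ` with respect to a bilinear operation `ℓ`. -/
def bilinStab {K V : Type*} [Field K] [AddCommGroup V] [Module K V]
    (ℓ : V →ₗ[K] V →ₗ[K] V) (γ : Module.Dual K V) : Submodule K V where
  carrier := {w | ∀ u : V, γ (ℓ w u) = 0}
  add_mem' {a b} ha hb := fun u => by
    rw [map_add, LinearMap.add_apply, map_add, ha u, hb u, add_zero]
  zero_mem' := fun u => by rw [map_zero, LinearMap.zero_apply, map_zero]
  smul_mem' c a ha := fun u => by
    rw [map_smul, LinearMap.smul_apply, map_smul, ha u, smul_zero]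

/-- The stabiliser `𝔮_γ = {x ∈ 𝔮 : γ([x,y]) = 0 ∀ y}` of a linear functional `γ ∈ 𝔮*`. -/
def lieStab (K L : Type*) [CommRing K] [LieRing L] [LieAlgebra K L]
    (γ : Module.Dual K L) : Submodule K L where
  carrier := {x | ∀ y : L, γ ⁅x, y⁆ = 0}
  add_mem' {a b} ha hb := fun y => by rw [add_lie, map_add, ha y, hb y, add_zero]
  zero_mem' := fun y => by rw [zero_lie, map_zero]
  smul_mem' c a ha := fun y => by rw [smul_lie, map_smul, ha y, smul_zero]

/-- The index of a Lie algebra: `ind 𝔮 = min_{γ ∈ 𝔮*} dim 𝔮_γ`. -/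
noncomputable def lieIndex (K L : Type*) [CommRing K] [LieRing L] [LieAlgebra K L] : ℕ :=
  ⨅ γ : Module.Dual K L, Module.finrank K (lieStab K L γ)

lemma exists_left_inv_mul {K : Type*} [Field K] {d k : ℕ} (V : Matrix (Fin d) (Fin k) K[X])
    (hV : Function.Injective V.mulVec) :
    ∃ (U : Matrix (Fin k) (Fin d) K[X]) (c : K[X]), c ≠ 0 ∧ U * V = c • (1 : Matrix _ _ K[X]) := by
  let F := FractionRing K[X]
  let φ : K[X] →+* F := algebraMap K[X] F
  have hφ : Function.Injective φ := IsFractionRing.injective K[X] F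
  have hinj : Function.Injective (V.map φ).mulVecLin := by
    rw [← LinearMap.ker_eq_bot, LinearMap.ker_eq_bot']
    intro x hx
    obtain ⟨b, hb⟩ := IsLocalization.exist_integer_multiples_of_finite
      (nonZeroDivisors K[X]) x
    choose y hy using hb
    have hb0 : φ (b : K[X]) ≠ 0 := by
      rw [Ne, map_eq_zero_iff φ hφ]
      exact nonZeroDivisors.ne_zero b.2
    have hy0 : V.mulVec y = 0 := by
      funext a
      apply hφ
      have h1 : (V.map φ).mulVec (fun i => φ (y i)) a = 0 := by
        have h2 : (fun i => φ (y i)) = φ (b : K[X]) • x := by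
          funext i
          simpa [Algebra.smul_def] using hy i
        rw [h2, Matrix.mulVec_smul]
        have : (V.map φ).mulVec x = 0 := hx
        simp [this]
      simpa [Matrix.mulVec, dotProduct] using h1
    have hy1 : y = 0 := hV (by rw [hy0, Matrix.mulVec_zero])
    funext i
    have := hy i
    rw [hy1, Algebra.smul_def] at this
    simp only [Pi.zero_apply, map_zero] at this
    exact (mul_eq_zero.1 this.symm).resolve_left hb0
  obtain ⟨g, hg⟩ := LinearMap.exists_leftInverse_of_injective _ (LinearMap.ker_eq_bot.2 hinj)
  have hG : LinearMap.toMatrix' g * V.map φ = 1 := by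
    have := congrArg LinearMap.toMatrix' hg
    rw [LinearMap.toMatrix'_comp, LinearMap.toMatrix'_id, ← Matrix.toLin'_apply',
      LinearMap.toMatrix'_toLin'] at this
    exact this
  obtain ⟨b, hb⟩ := IsLocalization.exist_integer_multiples_of_finite
      (nonZeroDivisors K[X]) (fun ij : Fin k × Fin d => LinearMap.toMatrix' g ij.1 ij.2)
  choose u hu using hb
  refine ⟨Matrix.of fun i j => u (i, j), b, nonZeroDivisors.ne_zero b.2, ?_⟩
  ext1 i j
  apply hφ
  have h3 := congrFun (congrFun hG i) j
  have h4 : ∀ a, φ (u (i, a)) = φ b * LinearMap.toMatrix' g i a := by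
    intro a
    have := hu (i, a)
    rwa [Algebra.smul_def] at this
  simp only [Matrix.mul_apply, Matrix.map_apply] at h3
  simp only [Matrix.mul_apply, Matrix.of_apply, map_sum, map_mul, h4, Matrix.smul_apply, smul_eq_mul, mul_assoc]
  rw [← Finset.mul_sum, h3]
  simp [Matrix.one_apply]

lemma finrank_range_le_of_eval {K : Type*} [Field K] [Infinite K] {d r : ℕ}
    (M : Matrix (Fin d) (Fin d) K[X])
    (h : ∀ s : K, (M.map (Polynomial.eval s)).rank ≤ r) :
    Module.finrank K[X] (LinearMap.range M.mulVecLin) ≤ r := by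
  set R := LinearMap.range M.mulVecLin with hR
  set k := Module.finrank K[X] R with hk
  let v : Module.Basis (Fin k) K[X] R := Module.finBasis K[X] R
  have hv : ∀ a, ∃ w, M.mulVecLin w = (v a : Fin d → K[X]) := fun a => (v a).2
  choose w hw using hv
  let Wm : Matrix (Fin d) (Fin k) K[X] := fun i a => w a i
  let V : Matrix (Fin d) (Fin k) K[X] := fun i a => (v a : Fin d → K[X]) i
  have hVM : V = M * Wm := by
    ext1 i a
    have := congrFun (hw a) i
    simp only [V, ← this]
    rfl
  have hVinj : Function.Injective V.mulVec := by
    rw [Matrix.mulVec_injective_iff]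
    have := v.linearIndependent.map' R.subtype (Submodule.ker_subtype R)
    exact this
  obtain ⟨U, c, hc, hUV⟩ := exists_left_inv_mul V hVinj
  obtain ⟨s, hs⟩ : ∃ s : K, c.eval s ≠ 0 := by
    by_contra hcon
    push Not at hcon
    exact hc (Polynomial.funext (by simpa using hcon))
  have key : (U.map (Polynomial.evalRingHom s)) * (M.map (Polynomial.evalRingHom s) *
      Wm.map (Polynomial.evalRingHom s)) = (c.eval s) • (1 : Matrix (Fin k) (Fin k) K) := by
    rw [← Matrix.map_mul, ← Matrix.map_mul, ← hVM, hUV]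
    ext i j
    by_cases hij : i = j <;> simp [hij]
  have h1 : ((c.eval s) • (1 : Matrix (Fin k) (Fin k) K)).rank = k := by
    rw [Matrix.rank_of_isUnit]
    · simp
    · exact (isUnit_one).smul (Units.mk0 _ hs)
  rw [← h1, ← key]
  refine (Matrix.rank_mul_le_right _ _).trans ((Matrix.rank_mul_le_left _ _).trans ?_)
  exact h s

/-- Truncation of a vector of polynomials to its first `m` coefficients. -/
noncomputable def truncVec (K : Type*) [Field K] (d m : ℕ) :
    (Fin d → K[X]) →ₗ[K] (Fin m → Fin d → K) :=
  LinearMap.pi fun j => LinearMap.pi fun b => Polynomial.lcoeff K j ∘ₗ LinearMap.proj b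

lemma finrank_truncVec_le {K : Type*} [Field K] {d m : ℕ} (R : Submodule K[X] (Fin d → K[X])) :
    Module.finrank K ((R.restrictScalars K).map (truncVec K d m)) ≤
      m * Module.finrank K[X] R := by
  set k := Module.finrank K[X] R with hk
  let v : Module.Basis (Fin k) K[X] R := Module.finBasis K[X] R
  let g : Fin m × Fin k → (Fin m → Fin d → K) := fun ia =>
    truncVec K d m ((X : K[X]) ^ (ia.1 : ℕ) • (v ia.2 : Fin d → K[X]))
  have hle : (R.restrictScalars K).map (truncVec K d m) ≤ Submodule.span K (Set.range g) := by
    rintro _ ⟨y, hy, rfl⟩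
    have h1 : y = ∑ a, v.repr ⟨y, hy⟩ a • (v a : Fin d → K[X]) := by
      have := congrArg Subtype.val (v.sum_repr ⟨y, hy⟩)
      simp only [Submodule.coe_sum, Submodule.coe_smul] at this
      exact this.symm
    rw [h1, map_sum]
    refine Submodule.sum_mem _ fun a _ => ?_
    rw [(v.repr ⟨y, hy⟩ a).as_sum_range_C_mul_X_pow, Finset.sum_smul, map_sum]
    refine Submodule.sum_mem _ fun i _ => ?_
    rw [← Polynomial.smul_eq_C_mul, smul_assoc, map_smul]
    refine Submodule.smul_mem _ _ ?_
    by_cases him : i < m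
    · exact Submodule.subset_span ⟨(⟨i, him⟩, a), rfl⟩
    · have : truncVec K d m ((X : K[X]) ^ i • (v a : Fin d → K[X])) = 0 := by
        funext j b
        have hj := j.2
        simp only [truncVec, LinearMap.pi_apply, LinearMap.comp_apply, LinearMap.proj_apply,
          Polynomial.lcoeff_apply, Pi.smul_apply, smul_eq_mul, Polynomial.coeff_X_pow_mul',
          Pi.zero_apply]
        rw [if_neg (by omega)]
      rw [this]
      exact Submodule.zero_mem _
  refine (Submodule.finrank_mono hle).trans ((finrank_range_le_card g).trans ?_)
  simp


lemma rank_lieMatrix {K Q : Type*} [Field K] [LieRing Q] [LieAlgebra K Q] [FiniteDimensional K Q]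
    {d : ℕ} (e : Module.Basis (Fin d) K Q) (ψ : Module.Dual K Q) :
    (Matrix.of fun b a => ψ ⁅e a, e b⁆ : Matrix (Fin d) (Fin d) K).rank +
      Module.finrank K (lieStab K Q ψ) = d := by
  let A : Q →ₗ[K] (Fin d → K) := LinearMap.pi fun b =>
    { toFun := fun x => ψ ⁅x, e b⁆
      map_add' := fun x y => by rw [add_lie, map_add]
      map_smul' := fun c x => by rw [smul_lie, map_smul]; rfl }
  have hA : (Matrix.of fun b a => ψ ⁅e a, e b⁆ : Matrix (Fin d) (Fin d) K) =
      LinearMap.toMatrix e (Pi.basisFun K (Fin d)) A := by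
    ext b a
    simp [LinearMap.toMatrix_apply, A]
  have hk : lieStab K Q ψ = LinearMap.ker A := by
    ext x
    rw [LinearMap.mem_ker]
    constructor
    · intro hx
      funext b
      exact hx (e b)
    · intro hx y
      have h1 : ∀ b, ψ ⁅x, e b⁆ = 0 := fun b => congrFun hx b
      rw [← e.sum_repr y, lie_sum, map_sum]
      refine Finset.sum_eq_zero fun b _ => ?_
      rw [lie_smul, map_smul, h1 b, smul_zero]
  rw [hA, Matrix.rank_eq_finrank_range_toLin _ (Pi.basisFun K (Fin d)) e, Matrix.toLin_toMatrix, hk,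
    LinearMap.finrank_range_add_finrank_ker, Module.finrank_eq_card_basis e, Fintype.card_fin]

lemma lieIndex_le {K Q : Type*} [Field K] [LieRing Q] [LieAlgebra K Q]
    (ψ : Module.Dual K Q) : lieIndex K Q ≤ Module.finrank K (lieStab K Q ψ) :=
  ciInf_le (OrderBot.bddBelow _) ψ

lemma core_lower {K Q : Type*} [Field K] [Infinite K] [LieRing Q] [LieAlgebra K Q]
    [FiniteDimensional K Q] (m : ℕ) (φ : ℕ → Module.Dual K Q) (hφ : ∀ k, k < m + 1 → φ k = 0)
    (S : Submodule K (Fin (m + 1) → Q))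
    (hS : ∀ F : Fin (m + 1) → Q, (∀ (j : Fin (m + 1)) (y : Q),
      ∑ i : Fin (m + 1), φ ((i : ℕ) + j) ⁅F i, y⁆ = 0) → F ∈ S) :
    Module.finrank K Q + m * lieIndex K Q ≤ Module.finrank K S := by
  set d := Module.finrank K Q with hd
  let e : Module.Basis (Fin d) K Q := Module.finBasis K Q
  let M : Matrix (Fin d) (Fin d) K[X] := Matrix.of fun b a =>
    ∑ k ∈ Finset.range m, C (φ (m + 1 + k) ⁅e a, e b⁆) * X ^ k
  let P : (Fin (m + 1) → Q) →ₗ[K] (Fin d → K[X]) := LinearMap.pi fun a =>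
    ∑ i : Fin (m + 1), Polynomial.monomial (m - (i : ℕ)) ∘ₗ e.coord a ∘ₗ LinearMap.proj i
  let T : (Fin (m + 1) → Q) →ₗ[K] (Fin m → Fin d → K) :=
    truncVec K d m ∘ₗ (M.mulVecLin.restrictScalars K) ∘ₗ P
  have hM : Module.finrank K[X] (LinearMap.range M.mulVecLin) ≤ d - lieIndex K Q := by
    apply finrank_range_le_of_eval
    intro s
    have h1 : M.map (Polynomial.eval s) = Matrix.of fun b a =>
        (∑ k ∈ Finset.range m, s ^ k • φ (m + 1 + k)) ⁅e a, e b⁆ := by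
      ext b a
      simp only [M, Matrix.map_apply, Matrix.of_apply, Polynomial.eval_finsetSum,
        Polynomial.eval_mul, Polynomial.eval_C, Polynomial.eval_pow, Polynomial.eval_X,
        LinearMap.sum_apply, LinearMap.smul_apply, smul_eq_mul]
      exact Finset.sum_congr rfl fun k _ => mul_comm _ _
    rw [h1]
    have h2 := rank_lieMatrix e (∑ k ∈ Finset.range m, s ^ k • φ (m + 1 + k))
    have h3 := lieIndex_le (∑ k ∈ Finset.range m, s ^ k • φ (m + 1 + k))
    omega
  have hrT : Module.finrank K (LinearMap.range T) ≤ m * (d - lieIndex K Q) := by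
    have h1 : LinearMap.range T ≤
        ((LinearMap.range M.mulVecLin).restrictScalars K).map (truncVec K d m) := by
      rintro _ ⟨F, rfl⟩
      exact ⟨M.mulVecLin (P F), ⟨P F, rfl⟩, rfl⟩
    refine (Submodule.finrank_mono h1).trans ((finrank_truncVec_le _).trans ?_)
    exact Nat.mul_le_mul_left _ hM
  have hTF : ∀ F (j : Fin m) (b : Fin d),
      T F j b = ∑ i : Fin (m + 1), φ ((i : ℕ) + (j + 1)) ⁅F i, e b⁆ := by
    intro F j b
    have h1 : T F j b = ∑ a, (M b a * P F a).coeff j := by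
      simp only [T, truncVec, LinearMap.comp_apply, LinearMap.pi_apply, LinearMap.proj_apply,
        Polynomial.lcoeff_apply]
      rw [← Polynomial.finsetSum_coeff]
      rfl
    have h2 : ∀ a, (M b a * P F a).coeff j = ∑ i : Fin (m + 1),
        e.repr (F i) a * φ ((i : ℕ) + (j + 1)) ⁅e a, e b⁆ := by
      intro a
      have hP : P F a = ∑ i : Fin (m + 1), C (e.repr (F i) a) * X ^ (m - (i : ℕ)) := by
        simp [P, LinearMap.sum_apply, ← Polynomial.C_mul_X_pow_eq_monomial]
      rw [hP, Finset.mul_sum, Polynomial.finsetSum_coeff]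
      refine Finset.sum_congr rfl fun i _ => ?_
      have hi := i.2
      have hj := j.2
      rw [mul_left_comm, Polynomial.coeff_C_mul, Polynomial.coeff_mul_X_pow']
      congr 1
      simp only [M, Matrix.of_apply, Polynomial.finsetSum_coeff, Polynomial.coeff_C_mul_X_pow]
      split_ifs with hij
      · rw [Finset.sum_ite_eq, if_pos (by rw [Finset.mem_range]; omega)]
        congr 2
        omega
      · rw [hφ _ (by omega), LinearMap.zero_apply]
    rw [h1, Finset.sum_congr rfl fun a _ => h2 a, Finset.sum_comm]
    refine Finset.sum_congr rfl fun i _ => ?_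
    conv_rhs => rw [← e.sum_repr (F i)]
    rw [sum_lie, map_sum]
    refine Finset.sum_congr rfl fun a _ => ?_
    rw [smul_lie, map_smul, smul_eq_mul]
  have hker : LinearMap.ker T ≤ S := by
    intro F hF
    rw [LinearMap.mem_ker] at hF
    apply hS
    intro j y
    refine Fin.cases ?_ (fun j => ?_) j
    · refine Finset.sum_eq_zero fun i _ => ?_
      have hi := i.2
      rw [hφ _ (by simpa using hi), LinearMap.zero_apply]
    · have h0 : ∀ b, ∑ i : Fin (m + 1), φ ((i : ℕ) + (j + 1)) ⁅F i, e b⁆ = 0 := by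
        intro b
        rw [← hTF, hF]; rfl
      rw [← e.sum_repr y]
      simp only [lie_sum, map_sum, lie_smul, map_smul, Fin.val_succ]
      rw [Finset.sum_comm]
      refine Finset.sum_eq_zero fun b _ => ?_
      rw [← Finset.smul_sum, h0, smul_zero]
  have h5 := LinearMap.finrank_range_add_finrank_ker T
  have h6 : Module.finrank K (Fin (m + 1) → Q) = (m + 1) * d := by
    rw [Module.finrank_pi_fintype]; simp [hd]
  have h7 := Submodule.finrank_mono hker
  have h8 : lieIndex K Q ≤ d := (lieIndex_le 0).trans (Submodule.finrank_le _)
  obtain ⟨r, hr⟩ := Nat.exists_eq_add_of_le h8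
  rw [h6] at h5
  have h9 : d - lieIndex K Q = r := by omega
  rw [h9] at hrT
  have h10 : m * d = m * lieIndex K Q + m * r := by
    conv_lhs => rw [hr]
    ring
  have h11 : (m + 1) * d = m * d + d := by ring
  omega

lemma core_upper {K Q : Type*} [Field K] [LieRing Q] [LieAlgebra K Q]
    [FiniteDimensional K Q] (m : ℕ) (a : ℕ → K) (ha : ∀ k, k < m + 1 → a k = 0)
    (ha' : a (m + 1) ≠ 0) (ψ : Module.Dual K Q)
    (S : Submodule K (Fin (m + 1) → Q))
    (hS : ∀ F ∈ S, ∀ (j : Fin (m + 1)) (y : Q),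
      ∑ i : Fin (m + 1), a ((i : ℕ) + j) * ψ ⁅F i, y⁆ = 0) :
    Module.finrank K S ≤ Module.finrank K Q + m * Module.finrank K (lieStab K Q ψ) := by
  have key : ∀ F ∈ S, ∀ t, ∀ i : Fin (m + 1), (i : ℕ) + t = m → t < m → F i ∈ lieStab K Q ψ := by
    intro F hF t
    induction t using Nat.strong_induction_on with
    | _ t ih =>
      intro i hit htm y
      have h1 := hS F hF ⟨t + 1, by omega⟩ y
      rw [Finset.sum_eq_single i] at h1
      · have h2 : (i : ℕ) + (t + 1) = m + 1 := by omega
        simp only [h2] at h1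
        exact (mul_eq_zero.1 h1).resolve_left ha'
      · intro i' _ hne
        have hne' : (i' : ℕ) ≠ i := fun h => hne (Fin.ext h)
        have hi' := i'.2
        rcases lt_or_gt_of_ne hne' with h | h
        · rw [ha _ (by simp only; omega), zero_mul]
        · have h3 : ψ ⁅F i', y⁆ = 0 := ih (m - i') (by omega) i' (by omega) (by omega) y
          rw [h3, mul_zero]
      · intro h
        exact absurd (Finset.mem_univ _) h
  let G : S →ₗ[K] Q × (Fin m → lieStab K Q ψ) :=
    LinearMap.prod (LinearMap.proj 0 ∘ₗ S.subtype)
      (LinearMap.pi fun i => LinearMap.codRestrict _ (LinearMap.proj i.succ ∘ₗ S.subtype)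
        (fun F => key F.1 F.2 (m - (i + 1)) i.succ
          (by have := i.2; simp only [Fin.val_succ]; omega) (by have := i.2; omega)))
  have hG : Function.Injective G := by
    intro F F' h
    have h1 : (F : Fin (m + 1) → Q) 0 = (F' : Fin (m + 1) → Q) 0 := congrArg Prod.fst h
    apply Subtype.ext
    funext i
    refine Fin.cases h1 (fun i => ?_) i
    exact congrArg Subtype.val (congrFun (congrArg Prod.snd h) i)
  have := LinearMap.finrank_le_finrank_of_injective hG
  rw [Module.finrank_prod, Module.finrank_pi_fintype] at this
  simpa using this

lemma diff_eq {K : Type*} [Field K] (m : ℕ) (p l h : K[X]) (hm : 1 ≤ m) (hp : p.Monic)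
    (hdeg : p.natDegree = m + 1) (hld : l.degree ≤ 1) (hh : h.natDegree ≤ 2 * m) :
    h %ₘ p - h %ₘ (p + l) = l * (h /ₘ p) := by
  have hpd : p.degree = ((m + 1 : ℕ) : WithBot ℕ) := by
    rw [Polynomial.degree_eq_natDegree hp.ne_zero, hdeg]
  have hlp : l.degree < p.degree := by
    refine lt_of_le_of_lt hld ?_
    rw [hpd]
    exact_mod_cast (by omega : 1 < m + 1)
  have hln : l.natDegree ≤ 1 := Polynomial.natDegree_le_of_degree_le hld
  have hmon : (p + l).Monic := hp.add_of_left hlp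
  have hq : (l * (h /ₘ p)).degree < p.degree := by
    rw [hpd]
    refine lt_of_le_of_lt Polynomial.degree_le_natDegree ?_
    have h1 := Polynomial.natDegree_mul_le (p := l) (q := h /ₘ p)
    have h2 := Polynomial.natDegree_divByMonic h hp
    exact_mod_cast (by omega : (l * (h /ₘ p)).natDegree < m + 1)
  have := (Polynomial.div_modByMonic_unique (f := h) (h /ₘ p) (h %ₘ p - l * (h /ₘ p)) hmon ⟨by
    have := Polynomial.modByMonic_add_div h p
    linear_combination this, by
    rw [Polynomial.degree_add_eq_left_of_degree_lt hlp]
    refine lt_of_le_of_lt (Polynomial.degree_sub_le _ _) (max_lt ?_ hq)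
    exact Polynomial.degree_modByMonic_lt _ hp⟩).2
  rw [this]
  ring

lemma divX_eq_one {K : Type*} [Field K] (p : K[X]) (hp : p.Monic) :
    (X ^ p.natDegree : K[X]) /ₘ p = 1 := by
  refine (Polynomial.div_modByMonic_unique 1 (X ^ p.natDegree - p) hp ⟨by ring, ?_⟩).1
  have hd : (X ^ p.natDegree : K[X]).degree = p.degree := by
    rw [Polynomial.degree_X_pow, Polynomial.degree_eq_natDegree hp.ne_zero]
  rw [← hd]
  refine Polynomial.degree_sub_lt hd (pow_ne_zero _ Polynomial.X_ne_zero) ?_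
  rw [hp.leadingCoeff, Polynomial.leadingCoeff_X_pow]

/-- The map `F ↦ ∑ tⁱ ⊗ Fᵢ`. -/
noncomputable def polyEmb (K Q : Type*) [Field K] [AddCommGroup Q] [Module K Q] (n : ℕ) :
    (Fin n → Q) →ₗ[K] K[X] ⊗[K] Q :=
  ∑ i : Fin n, TensorProduct.mk K K[X] Q (X ^ (i : ℕ)) ∘ₗ LinearMap.proj i

lemma polyEmb_apply {K Q : Type*} [Field K] [AddCommGroup Q] [Module K Q] {n : ℕ}
    (F : Fin n → Q) : polyEmb K Q n F = ∑ i : Fin n, (X ^ (i : ℕ) : K[X]) ⊗ₜ[K] F i := by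
  simp [polyEmb, LinearMap.sum_apply]

lemma polyEmb_single {K Q : Type*} [Field K] [AddCommGroup Q] [Module K Q] {n : ℕ}
    (i : Fin n) (x : Q) : polyEmb K Q n (Pi.single i x) = (X ^ (i : ℕ) : K[X]) ⊗ₜ[K] x := by
  rw [polyEmb_apply, Finset.sum_eq_single i]
  · simp
  · intro j _ hj
    simp [Pi.single_eq_of_ne hj]
  · simp

lemma polyEmb_injective {K Q : Type*} [Field K] [AddCommGroup Q] [Module K Q] {n : ℕ} :
    Function.Injective (polyEmb K Q n) := by
  rw [← LinearMap.ker_eq_bot, LinearMap.ker_eq_bot']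
  intro F hF
  funext j
  have h := congrArg (fun z => TensorProduct.lid K Q ((Polynomial.lcoeff K (j : ℕ)).rTensor Q z)) hF
  simp only [polyEmb_apply, map_sum, LinearMap.rTensor_tmul, TensorProduct.lid_tmul,
    Polynomial.lcoeff_apply, Polynomial.coeff_X_pow, map_zero] at h
  rw [Finset.sum_eq_single j] at h
  · simpa using h
  · intro i _ hij
    rw [if_neg (fun hh => hij (Fin.ext hh.symm)), zero_smul]
  · simp

lemma polyEmb_range {K Q : Type*} [Field K] [AddCommGroup Q] [Module K Q] {n : ℕ} :
    LinearMap.range (polyEmb K Q n) = Submodule.span K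
      {z : Polynomial K ⊗[K] Q | ∃ (f : Polynomial K) (x : Q),
        f.degree < (n : WithBot ℕ) ∧ z = f ⊗ₜ x} := by
  apply le_antisymm
  · rintro _ ⟨F, rfl⟩
    rw [polyEmb_apply]
    refine Submodule.sum_mem _ fun i _ => Submodule.subset_span ⟨_, _, ?_, rfl⟩
    rw [Polynomial.degree_X_pow]
    exact_mod_cast i.2
  · rw [Submodule.span_le]
    rintro _ ⟨f, x, hf, rfl⟩
    refine ⟨fun i => f.coeff i • x, ?_⟩
    rw [polyEmb_apply]
    by_cases hn : n = 0
    · subst hn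
      have : f = 0 := by
        rw [← Polynomial.degree_eq_bot]
        exact Nat.WithBot.lt_zero_iff.1 (by simpa using hf)
      simp [this]
    · have h1 : f.natDegree < n := by
        by_cases h0 : f = 0
        · subst h0
          simp only [Polynomial.natDegree_zero]; omega
        · exact (Polynomial.natDegree_lt_iff_degree_lt h0).2 hf
      conv_rhs => rw [Polynomial.as_sum_range_C_mul_X_pow' f h1]
      rw [TensorProduct.sum_tmul, Finset.sum_range]
      refine Finset.sum_congr rfl fun i _ => ?_
      rw [← Polynomial.smul_eq_C_mul, TensorProduct.smul_tmul]

/-- The index of the Lie algebra `(W, ℓ)`, where `W = K[t]_{<n} ⊗ 𝔮` (realised as the subspace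
of `K[t] ⊗ 𝔮` spanned by `f ⊗ x` with `deg f < n`, via the embedding `ι`) and
`ℓ = [ , ]_p - [ , ]_{p+l}`, equals `dim 𝔮 + (n-1)·ind 𝔮`. -/
theorem index_of_difference_bracket
    (K : Type*) [Field K] [IsAlgClosed K] [CharZero K]
    (Q : Type*) [LieRing Q] [LieAlgebra K Q] [FiniteDimensional K Q]
    (n : ℕ) (hn : 2 ≤ n)
    (p : Polynomial K) (hp : p.Monic) (hdeg : p.natDegree = n)
    (l : Polynomial K) (hl : l ≠ 0) (hld : l.degree ≤ 1)
    (W : Type*) [AddCommGroup W] [Module K W]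
    (ι : W →ₗ[K] Polynomial K ⊗[K] Q) (hinj : Function.Injective ι)
    (hrange : LinearMap.range ι = Submodule.span K
      {z : Polynomial K ⊗[K] Q | ∃ (f : Polynomial K) (x : Q),
        f.degree < (n : WithBot ℕ) ∧ z = f ⊗ₜ x})
    (ℓ : W →ₗ[K] W →ₗ[K] W)
    (hℓ : ∀ (u v : W) (f g : Polynomial K) (x y : Q),
      ι u = f ⊗ₜ x → ι v = g ⊗ₜ y →
      ι (ℓ u v) = ((f * g) %ₘ p - (f * g) %ₘ (p + l)) ⊗ₜ ⁅x, y⁆) :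
    (⨅ γ : Module.Dual K W, Module.finrank K (bilinStab ℓ γ)) =
      Module.finrank K Q + (n - 1) * lieIndex K Q := by
  obtain ⟨m, rfl⟩ : ∃ m, n = m + 1 := ⟨n - 1, by omega⟩
  have hm : 1 ≤ m := by omega
  rw [Nat.add_sub_cancel]
  rw [← polyEmb_range] at hrange
  let E : (Fin (m + 1) → Q) ≃ₗ[K] W :=
    (LinearEquiv.ofInjective (polyEmb K Q (m + 1)) polyEmb_injective).trans
      ((LinearEquiv.ofEq _ _ hrange.symm).trans (LinearEquiv.ofInjective ι hinj).symm)
  have hE : ∀ F, ι (E F) = polyEmb K Q (m + 1) F := by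
    intro F
    have h1 := (LinearEquiv.ofInjective ι hinj).apply_symm_apply
      (LinearEquiv.ofEq _ _ hrange.symm
        (LinearEquiv.ofInjective (polyEmb K Q (m + 1)) polyEmb_injective F))
    exact congrArg Subtype.val h1
  have hmem : ∀ (Γ : K[X] ⊗[K] Q →ₗ[K] K) (F : Fin (m + 1) → Q),
      E F ∈ bilinStab ℓ (Γ ∘ₗ ι) ↔ ∀ (j : Fin (m + 1)) (y : Q),
        ∑ i : Fin (m + 1), Γ ((l * ((X ^ ((i : ℕ) + j) : K[X]) /ₘ p)) ⊗ₜ ⁅F i, y⁆) = 0 := by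
    intro Γ F
    have hform : ∀ (j : Fin (m + 1)) (y : Q), (Γ ∘ₗ ι) (ℓ (E F) (E (Pi.single j y))) =
        ∑ i : Fin (m + 1), Γ ((l * ((X ^ ((i : ℕ) + j) : K[X]) /ₘ p)) ⊗ₜ ⁅F i, y⁆) := by
      intro j y
      have hF : F = ∑ i, Pi.single i (F i) := (Finset.univ_sum_single F).symm
      conv_lhs => rw [hF]
      simp only [map_sum, LinearMap.sum_apply]
      refine Finset.sum_congr rfl fun i _ => ?_
      rw [LinearMap.comp_apply, hℓ _ _ (X ^ (i : ℕ)) (X ^ (j : ℕ)) (F i) y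
        (by rw [hE, polyEmb_single]) (by rw [hE, polyEmb_single]), ← pow_add,
        diff_eq m p l _ hm hp hdeg hld]
      rw [Polynomial.natDegree_X_pow]
      have := i.2
      have := j.2
      omega
    constructor
    · intro h j y
      rw [← hform]
      exact h _
    · intro h u
      obtain ⟨G, rfl⟩ := E.surjective u
      rw [← Finset.univ_sum_single G]
      rw [map_sum, map_sum, map_sum]
      refine Finset.sum_eq_zero fun j _ => ?_
      rw [hform, h]
  have hfr : ∀ γ : Module.Dual K W, Module.finrank K
      ((bilinStab ℓ γ).map (E.symm : W →ₗ[K] (Fin (m + 1) → Q))) =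
      Module.finrank K (bilinStab ℓ γ) := fun γ => LinearEquiv.finrank_map_eq E.symm _
  have hmem' : ∀ (γ : Module.Dual K W) (F : Fin (m + 1) → Q),
      F ∈ (bilinStab ℓ γ).map (E.symm : W →ₗ[K] (Fin (m + 1) → Q)) ↔ E F ∈ bilinStab ℓ γ := by
    intro γ F
    constructor
    · rintro ⟨w, hw, rfl⟩
      simpa using hw
    · intro h
      exact ⟨E F, h, by simp⟩
  have hdiv0 : ∀ k, k < m + 1 → (X ^ k : K[X]) /ₘ p = 0 := by
    intro k hk
    rw [Polynomial.divByMonic_eq_zero_iff hp, Polynomial.degree_X_pow,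
      Polynomial.degree_eq_natDegree hp.ne_zero, hdeg]
    exact_mod_cast hk
  apply le_antisymm
  · obtain ⟨ψ, hψ⟩ : ∃ ψ : Module.Dual K Q,
        Module.finrank K (lieStab K Q ψ) = lieIndex K Q :=
      ciInf_mem (fun γ : Module.Dual K Q => Module.finrank K (lieStab K Q γ))
    let α : K[X] →ₗ[K] K := Polynomial.lcoeff K l.natDegree
    let Γ : K[X] ⊗[K] Q →ₗ[K] K := TensorProduct.lid K K ∘ₗ TensorProduct.map α ψ
    refine (ciInf_le (OrderBot.bddBelow _) (Γ ∘ₗ ι)).trans ?_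
    rw [← hfr, ← hψ]
    refine core_upper m (fun k => α (l * ((X ^ k : K[X]) /ₘ p))) ?_ ?_ ψ _ ?_
    · intro k hk
      simp only [hdiv0 k hk, mul_zero, map_zero]
    · have h1 := divX_eq_one p hp
      rw [hdeg] at h1
      simp only [h1, mul_one, α, Polynomial.lcoeff_apply]
      exact Polynomial.leadingCoeff_ne_zero.2 hl
    · intro F hF j y
      have := (hmem Γ F).1 ((hmem' _ F).1 hF) j y
      simpa [Γ] using this
  · refine le_ciInf fun γ => ?_
    obtain ⟨π, hπ⟩ := LinearMap.exists_leftInverse_of_injective ι (LinearMap.ker_eq_bot.2 hinj)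
    have hγ : γ = (γ ∘ₗ π) ∘ₗ ι := by
      rw [LinearMap.comp_assoc, hπ, LinearMap.comp_id]
    rw [← hfr]
    refine core_lower m (fun k => (γ ∘ₗ π) ∘ₗ
      TensorProduct.mk K K[X] Q (l * ((X ^ k : K[X]) /ₘ p))) ?_ _ ?_
    · intro k hk
      simp only [hdiv0 k hk, mul_zero, map_zero, LinearMap.comp_zero]
    · intro F hF
      rw [hmem', hγ, hmem]
      intro j y
      exact hF j y
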